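/- arXiv:2306.13527 — 2 statements merged into one kernel-verified Lean document; each statement's English description precedes it below -/
import Mathlib

section
/- For every n≥1 and s>0, the set G^n_s equals the union over δ∈(0,1] and β>0 of the sets G^n_s(δ,β). -/
noncomputable section
open Complex

/-- The ℓ¹ norm of an integer vector. -/
def norm1 {n : ℕ} (k : Fin n → ℤ) : ℕ := ∑ i, (k i).natAbs

/-- Integer vectors whose first nonzero component is positive. -/
def Zstar (n : ℕ) : Set (Fin n → ℤ) := {k | ∃ j, 0 < k j ∧ ∀ i, i < j → k i = 0}

/-- Generators of one-dimensional maximal lattices in ℤⁿ. -/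
def gen (n : ℕ) : Set (Fin n → ℤ) :=
  {k | k ∈ Zstar n ∧ Finset.univ.gcd (fun i => (k i).natAbs) = 1}

/-- Generators of size at most `K`. -/
def genK (n : ℕ) (K : ℝ) : Set (Fin n → ℤ) := {k | k ∈ gen n ∧ (norm1 k : ℝ) ≤ K}

/-- `c` is the family of Fourier coefficients of a zero-average real analytic
function in the closed unit ball of the norm `‖f‖ₛ = sup |f_k| e^{s|k|₁}`. -/
structure InBall (n : ℕ) (s : ℝ) (c : (Fin n → ℤ) → ℂ) : Prop where
  zero : c 0 = 0
  real : ∀ k, c (-k) = (starRingEnd ℂ) (c k)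
  bound : ∀ k, ‖c k‖ * Real.exp (s * norm1 k) ≤ 1

/-- The Fourier cut-off `N(δ)`. -/
def Ncut (n : ℕ) (s δ : ℝ) : ℝ :=
  2 * max 1 (1/s * Real.log (2^44 * (2*(n:ℝ) / Real.exp 1)^n / (s^n * δ)))

/-- Condition (P1+) with parameter δ. -/
def P1plus (n : ℕ) (s δ : ℝ) (c : (Fin n → ℤ) → ℂ) : Prop :=
  ∀ k ∈ gen n, Ncut n s δ ≤ (norm1 k : ℝ) →
    δ / (norm1 k : ℝ)^n * Real.exp (-(s * norm1 k)) ≤ ‖c k‖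

/-- Complex extension of the Fourier projection `π_{ℤk} f` onto modes proportional to `k`. -/
def projC {n : ℕ} (c : (Fin n → ℤ) → ℂ) (k : Fin n → ℤ) (θ : ℂ) : ℂ :=
  ∑' j : ℤ, if j = 0 then 0 else c (j • k) * Complex.exp (Complex.I * (j : ℂ) * θ)

/-- Real restriction of the Fourier projection `π_{ℤk} f`. -/
def projR {n : ℕ} (c : (Fin n → ℤ) → ℂ) (k : Fin n → ℤ) (θ : ℝ) : ℝ :=
  (projC c k (θ : ℂ)).re

/-- `F` is a `β`-Morse function on the torus `ℝ/2πℤ`. -/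
def BetaMorse (β : ℝ) (F : ℝ → ℝ) : Prop :=
  (∀ θ : ℝ, β ≤ |deriv F θ| + |deriv (deriv F) θ|) ∧
  (∀ θ₁ θ₂ : ℝ, deriv F θ₁ = 0 → deriv F θ₂ = 0 →
    (¬ ∃ m : ℤ, θ₁ - θ₂ = 2 * Real.pi * m) → β ≤ |F θ₁ - F θ₂|)

/-- `F` is a Morse function with distinct critical values on the torus `ℝ/2πℤ`. -/
def MorseWithDistinctValues (F : ℝ → ℝ) : Prop :=
  (∀ θ : ℝ, deriv F θ = 0 → deriv (deriv F) θ ≠ 0) ∧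
  (∀ θ₁ θ₂ : ℝ, deriv F θ₁ = 0 → deriv F θ₂ = 0 → F θ₁ = F θ₂ →
    ∃ m : ℤ, θ₁ - θ₂ = 2 * Real.pi * m)

/-- The liminf condition (P1): `liminf |f_k| e^{s|k|₁} |k|₁ⁿ > 0` along `k ∈ 𝒢ⁿ`. -/
def LiminfPos (n : ℕ) (s : ℝ) (c : (Fin n → ℤ) → ℂ) : Prop :=
  ∃ d : ℝ, 0 < d ∧ ∃ N : ℝ, ∀ k ∈ gen n, N ≤ (norm1 k : ℝ) →
    d ≤ ‖c k‖ * Real.exp (s * norm1 k) * (norm1 k : ℝ)^n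

/-- The generic class `𝔾ⁿₛ` (in terms of Fourier coefficients). -/
def Gset (n : ℕ) (s : ℝ) : Set ((Fin n → ℤ) → ℂ) :=
  {c | InBall n s c ∧ LiminfPos n s c ∧ ∀ k ∈ gen n, MorseWithDistinctValues (projR c k)}

/-- The class `𝔾ⁿₛ(δ,β)`. -/
def GsetDB (n : ℕ) (s δ β : ℝ) : Set ((Fin n → ℤ) → ℂ) :=
  {c | InBall n s c ∧ P1plus n s δ c ∧
    ∀ k ∈ gen n, (norm1 k : ℝ) ≤ Ncut n s δ → BetaMorse β (projR c k)}


/-- The trigonometric series on the real line with coefficients `a`. -/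
def trigSeries (a : ℤ → ℂ) (θ : ℝ) : ℂ := ∑' j : ℤ, a j * Complex.exp (I * j * θ)

/-- The coefficients of the termwise derivative of a trigonometric series. -/
def derivCoeff (a : ℤ → ℂ) (j : ℤ) : ℂ := I * j * a j

lemma norm_derivCoeff (a : ℤ → ℂ) (j : ℤ) : ‖derivCoeff a j‖ = (j.natAbs : ℝ) * ‖a j‖ := by
  simp [derivCoeff, Nat.cast_natAbs]

lemma norm_exp_I_mul_int_mul (j : ℤ) (θ : ℝ) : ‖Complex.exp (I * j * θ)‖ = 1 := by
  rw [show I * (j : ℂ) * θ = ((j * θ : ℝ) : ℂ) * I by push_cast; ring]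
  exact norm_exp_ofReal_mul_I _

lemma norm_trigSeries_le {a : ℤ → ℂ} {u : ℤ → ℝ} (hu : Summable u)
    (h : ∀ j, ‖a j‖ ≤ u j) (θ : ℝ) : ‖trigSeries a θ‖ ≤ ∑' j, u j :=
  tsum_of_norm_bounded hu.hasSum fun j => by
    rw [norm_mul, norm_exp_I_mul_int_mul, mul_one]; exact h j

lemma hasDerivAt_trigSeries {a : ℤ → ℂ} (h0 : Summable fun j => ‖a j‖)
    (h1 : Summable fun j => ‖derivCoeff a j‖) (θ : ℝ) :
    HasDerivAt (trigSeries a) (trigSeries (derivCoeff a) θ) θ := by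
  refine hasDerivAt_tsum (y₀ := 0)
    (g := fun (j : ℤ) (y : ℝ) => a j * Complex.exp (I * j * y))
    (g' := fun (j : ℤ) (y : ℝ) => derivCoeff a j * Complex.exp (I * j * y)) h1 (fun j y => ?_) (fun j y => ?_) ?_ θ
  · have h : HasDerivAt (fun z : ℝ => I * (j : ℂ) * (z : ℂ)) (I * j * 1) y :=
      (hasDerivAt_id y).ofReal_comp.const_mul _
    exact (h.cexp.const_mul (a j)).congr_deriv (by simp only [derivCoeff]; ring)
  · rw [norm_mul, norm_exp_I_mul_int_mul, mul_one]
  · refine Summable.of_norm (h0.congr fun j => ?_)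
    rw [norm_mul, norm_exp_I_mul_int_mul, mul_one]

lemma hasDerivAt_re {f : ℝ → ℂ} {f' : ℂ} {θ : ℝ} (h : HasDerivAt f f' θ) :
    HasDerivAt (fun x => (f x).re) f'.re θ :=
  Complex.reCLM.hasFDerivAt.comp_hasDerivAt θ h

lemma periodic_trigSeries (a : ℤ → ℂ) : Function.Periodic (trigSeries a) (2 * Real.pi) := by
  intro θ
  refine tsum_congr fun j => ?_
  congr 1
  rw [Complex.exp_eq_exp_iff_exists_int]
  exact ⟨j, by push_cast; ring⟩

lemma summable_natAbs_pow_mul_geometric (m : ℕ) {q : ℝ} (h0 : 0 ≤ q) (h1 : q < 1) :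
    Summable fun j : ℤ => (j.natAbs : ℝ) ^ m * q ^ j.natAbs := by
  have h := summable_pow_mul_geometric_of_norm_lt_one m
    (show ‖q‖ < 1 by rwa [Real.norm_of_nonneg h0])
  exact Summable.of_nat_of_neg (by simpa using h) (by simpa using h)

/-- A periodic `C²` Morse function with distinct critical values is `β`-Morse for some `β > 0`. -/
lemma MorseWithDistinctValues.exists_betaMorse {F F' F'' : ℝ → ℝ}
    (h1 : ∀ θ, HasDerivAt F (F' θ) θ) (h2 : ∀ θ, HasDerivAt F' (F'' θ) θ)
    (hc : Continuous F'') (hp : Function.Periodic F (2 * Real.pi))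
    (hp' : Function.Periodic F' (2 * Real.pi)) (hp'' : Function.Periodic F'' (2 * Real.pi))
    (hM : MorseWithDistinctValues F) : ∃ β, 0 < β ∧ BetaMorse β F := by
  have e1 : deriv F = F' := funext fun θ => (h1 θ).deriv
  have e2 : deriv F' = F'' := funext fun θ => (h2 θ).deriv
  obtain ⟨hM1, hM2⟩ := hM
  unfold BetaMorse
  rw [e1] at hM1 hM2 ⊢
  rw [e2] at hM1 ⊢
  have hpi : 0 < 2 * Real.pi := Real.two_pi_pos
  have hc' : Continuous F' := continuous_iff_continuousAt.2 fun θ => (h2 θ).continuousAt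
  have hshift : ∀ θ : ℝ, ∃ m : ℤ, θ - m * (2 * Real.pi) ∈ Set.Icc 0 (2 * Real.pi) := by
    intro θ
    refine ⟨⌊θ / (2 * Real.pi)⌋, ?_, ?_⟩
    · have := (le_div_iff₀ hpi).1 (Int.floor_le (θ / (2 * Real.pi)))
      linarith
    · have := (div_lt_iff₀ hpi).1 (Int.lt_floor_add_one (θ / (2 * Real.pi)))
      linarith
  obtain ⟨x₀, -, hx₀⟩ := (isCompact_Icc (a := (0 : ℝ)) (b := 2 * Real.pi)).exists_isMinOn
    (Set.nonempty_Icc.2 hpi.le) ((hc'.abs.add hc.abs).continuousOn)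
  have hpos : 0 < |F' x₀| + |F'' x₀| := by
    rcases eq_or_ne (F' x₀) 0 with h | h
    · have := abs_pos.2 (hM1 x₀ h)
      positivity
    · have := abs_pos.2 h
      positivity
  set Z : Set ℝ := {θ | θ ∈ Set.Icc 0 (2 * Real.pi) ∧ F' θ = 0}
  have hfin : Z.Finite := by
    by_contra hinf
    obtain ⟨x, -, hx⟩ := Set.Infinite.exists_accPt_of_subset_isCompact hinf
      (isCompact_Icc (a := (0 : ℝ)) (b := 2 * Real.pi)) (fun θ h => h.1)
    rw [accPt_iff_frequently_nhdsNE] at hx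
    have hx0 : F' x = 0 := by
      by_contra hne
      have h3 := (hc'.continuousAt.eventually_ne hne : ∀ᶠ z in nhds x, F' z ≠ 0)
      obtain ⟨z, hz, hz'⟩ := (hx.and_eventually (h3.filter_mono nhdsWithin_le_nhds)).exists
      exact hz' hz.2
    obtain ⟨z, hz, hz'⟩ :=
      (hx.and_eventually ((h2 x).eventually_ne (c := 0) (hM1 x hx0))).exists
    exact hz' hz.2
  set P : Set (ℝ × ℝ) := {p | p ∈ Z ×ˢ Z ∧ F p.1 ≠ F p.2}
  have hP : P.Finite := (hfin.prod hfin).subset fun p hp => hp.1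
  obtain ⟨γ, hγ, hγP⟩ : ∃ γ : ℝ, 0 < γ ∧ ∀ p ∈ P, γ ≤ |F p.1 - F p.2| := by
    rcases P.eq_empty_or_nonempty with h | h
    · exact ⟨1, one_pos, by simp [h]⟩
    · obtain ⟨p, hp, hmin⟩ := Set.exists_min_image P (fun p => |F p.1 - F p.2|) hP h
      exact ⟨_, abs_pos.2 (sub_ne_zero.2 hp.2), hmin⟩
  refine ⟨min (|F' x₀| + |F'' x₀|) γ, lt_min hpos hγ, fun θ => ?_, fun θ₁ θ₂ c₁ c₂ hne => ?_⟩
  · obtain ⟨m, hm⟩ := hshift θ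
    have h3 : |F' x₀| + |F'' x₀| ≤ _ := hx₀ hm
    simp only [Pi.add_apply, hp'.sub_int_mul_eq, hp''.sub_int_mul_eq] at h3
    exact (min_le_left _ _).trans h3
  · obtain ⟨m₁, hm₁⟩ := hshift θ₁
    obtain ⟨m₂, hm₂⟩ := hshift θ₂
    have h3 := hγP (θ₁ - m₁ * (2 * Real.pi), θ₂ - m₂ * (2 * Real.pi))
      ⟨⟨⟨hm₁, by rw [hp'.sub_int_mul_eq, c₁]⟩, ⟨hm₂, by rw [hp'.sub_int_mul_eq, c₂]⟩⟩, by
        simp only [hp.sub_int_mul_eq]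
        exact fun h => hne (hM2 θ₁ θ₂ c₁ c₂ h)⟩
    simp only [hp.sub_int_mul_eq] at h3
    exact (min_le_right _ _).trans h3

lemma abs_le_of_abs_sin_sub_le {x y : ℝ} (hx : |x - y| ≤ Real.pi)
    (hcos : 1 / 2 ≤ Real.cos (x + y)) :
    |x - y| ≤ 4 * |Real.sin x - Real.sin y| := by
  have h1 : 1 / 2 ≤ |Real.cos ((x + y) / 2)| := by
    have h := Real.cos_sq ((x + y) / 2)
    rw [mul_div_cancel₀ _ two_ne_zero] at h
    rw [← sq_abs] at h
    nlinarith [abs_nonneg (Real.cos ((x + y) / 2))]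
  have h2 : |x - y| / 4 ≤ |Real.sin ((x - y) / 2)| := by
    have h := Real.mul_abs_le_abs_sin (x := (x - y) / 2)
      (by rw [abs_div, abs_two]; linarith)
    rw [abs_div, abs_two] at h
    refine le_trans ?_ h
    have : 1 / 2 ≤ 2 / Real.pi := by
      rw [div_le_div_iff₀ two_pos Real.pi_pos]; linarith [Real.pi_le_four]
    nlinarith [abs_nonneg (x - y)]
  rw [Real.sin_sub_sin, abs_mul, abs_mul, abs_two]
  nlinarith [abs_nonneg (x - y), abs_nonneg (Real.sin ((x - y) / 2))]

/-- A small `C²` perturbation of a shifted cosine is Morse with distinct critical values. -/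
lemma morseWithDistinctValues_of_near_cos {A φ η : ℝ} {F R R' R'' : ℝ → ℝ} (hA : 0 < A)
    (hη : η ≤ A / 100)
    (h1 : ∀ θ, HasDerivAt R (R' θ) θ) (h2 : ∀ θ, HasDerivAt R' (R'' θ) θ)
    (hp : Function.Periodic R' (2 * Real.pi))
    (b0 : ∀ θ, |R θ| ≤ η) (b1 : ∀ θ, |R' θ| ≤ η) (b2 : ∀ θ, |R'' θ| ≤ η)
    (hF : ∀ θ, F θ = A * Real.cos (θ + φ) + R θ) : MorseWithDistinctValues F := by
  have hadd : ∀ θ, HasDerivAt (fun x : ℝ => x + φ) 1 θ := fun θ =>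
    (hasDerivAt_id θ).add_const φ
  have e1 : deriv F = fun θ => -(A * Real.sin (θ + φ)) + R' θ := by
    rw [funext hF]
    exact funext fun θ => ((((hadd θ).cos.const_mul A).add (h1 θ)).congr_deriv (by ring)).deriv
  have e2 : deriv (deriv F) = fun θ => -(A * Real.cos (θ + φ)) + R'' θ := by
    rw [e1]
    exact funext fun θ =>
      ((((hadd θ).sin.const_mul A).neg.add (h2 θ)).congr_deriv (by ring)).deriv
  have hsin : ∀ θ, deriv F θ = 0 → |Real.sin (θ + φ)| ≤ 1 / 100 := by
    intro θ h
    simp only [e1] at h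
    have h3 : A * |Real.sin (θ + φ)| ≤ A / 100 := by
      rw [← abs_of_pos hA, ← abs_mul, abs_of_pos hA, show A * Real.sin (θ + φ) = R' θ by linarith]
      exact (b1 θ).trans hη
    nlinarith
  have hcos : ∀ θ, deriv F θ = 0 → 99 / 100 ≤ Real.cos (θ + φ) ^ 2 := by
    intro θ h
    have h3 := Real.sin_sq_add_cos_sq (θ + φ)
    have h4 := hsin θ h
    rw [← sq_abs (Real.sin _)] at h3
    nlinarith [abs_nonneg (Real.sin (θ + φ))]
  refine ⟨fun θ h h' => ?_, fun θ₁ θ₂ c₁ c₂ hv => ?_⟩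
  · have h3 := hcos θ h
    simp only [e2] at h'
    have h4 : A * |Real.cos (θ + φ)| ≤ A / 100 := by
      rw [← abs_of_pos hA, ← abs_mul, abs_of_pos hA,
        show A * Real.cos (θ + φ) = R'' θ by linarith]
      exact (b2 θ).trans hη
    have h5 : |Real.cos (θ + φ)| ≤ 1 / 100 := by nlinarith
    rw [← sq_abs] at h3
    nlinarith [abs_nonneg (Real.cos (θ + φ))]
  set m : ℤ := round ((θ₁ - θ₂) / (2 * Real.pi)) with hm
  have hpi : 0 < 2 * Real.pi := Real.two_pi_pos
  have hclose : |θ₁ - θ₂ - m * (2 * Real.pi)| ≤ Real.pi := by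
    have h := abs_sub_round ((θ₁ - θ₂) / (2 * Real.pi))
    rw [← hm] at h
    have h3 : θ₁ - θ₂ - m * (2 * Real.pi)
        = ((θ₁ - θ₂) / (2 * Real.pi) - m) * (2 * Real.pi) := by
      field_simp
    rw [h3, abs_mul, abs_of_pos hpi]
    nlinarith
  set x := θ₁ - m * (2 * Real.pi) with hx
  have sx : Real.sin (x + φ) = Real.sin (θ₁ + φ) := by
    rw [show x + φ = θ₁ + φ - m * (2 * Real.pi) by rw [hx]; ring, Real.sin_sub_int_mul_two_pi]
  have cx : Real.cos (x + φ) = Real.cos (θ₁ + φ) := by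
    rw [show x + φ = θ₁ + φ - m * (2 * Real.pi) by rw [hx]; ring, Real.cos_sub_int_mul_two_pi]
  have rx : R' x = R' θ₁ := hp.sub_int_mul_eq m
  have hs₁ := hsin θ₁ c₁
  have hs₂ := hsin θ₂ c₂
  have hc₁ := hcos θ₁ c₁
  have hc₂ := hcos θ₂ c₂
  rw [hF, hF] at hv
  simp only [e1] at c₁ c₂
  have hcc : |Real.cos (θ₁ + φ) - Real.cos (θ₂ + φ)| ≤ 2 / 100 := by
    have h : A * |Real.cos (θ₁ + φ) - Real.cos (θ₂ + φ)| ≤ A * (2 / 100) := by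
      rw [← abs_of_pos hA, ← abs_mul, abs_of_pos hA,
        show A * (Real.cos (θ₁ + φ) - Real.cos (θ₂ + φ)) = R θ₂ - R θ₁ by linarith]
      linarith [abs_sub (R θ₂) (R θ₁), b0 θ₁, b0 θ₂]
    exact le_of_mul_le_mul_left h hA
  have hcsum : 1 / 2 ≤ Real.cos ((x + φ) + (θ₂ + φ)) := by
    rw [Real.cos_add, sx, cx]
    have h : |Real.sin (θ₁ + φ) * Real.sin (θ₂ + φ)| ≤ 1 / 100 * (1 / 100) := by
      rw [abs_mul]; gcongr
    have h4 := sq_le_sq' (by linarith [(abs_le.1 hcc).1]) (abs_le.1 hcc).2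
    nlinarith [(abs_le.1 h).2]
  have hxle := abs_le_of_abs_sin_sub_le (x := x + φ) (y := θ₂ + φ)
    (by rwa [show x + φ - (θ₂ + φ) = θ₁ - θ₂ - m * (2 * Real.pi) by rw [hx]; ring]) hcsum
  rw [show x + φ - (θ₂ + φ) = x - θ₂ by ring, sx] at hxle
  have hR : |R' x - R' θ₂| ≤ η * |x - θ₂| := by
    have := Convex.norm_image_sub_le_of_norm_hasDerivWithin_le (f := R') (f' := R'')
      (s := Set.univ) (C := η) (x := θ₂) (y := x)
      (fun θ _ => (h2 θ).hasDerivWithinAt) (fun θ _ => b2 θ) convex_univ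
      (Set.mem_univ _) (Set.mem_univ _)
    simpa using this
  have hdiff : A * |Real.sin (θ₁ + φ) - Real.sin (θ₂ + φ)| ≤ A / 100 * |x - θ₂| := by
    rw [← abs_of_pos hA, ← abs_mul, abs_of_pos hA,
      show A * (Real.sin (θ₁ + φ) - Real.sin (θ₂ + φ)) = R' x - R' θ₂ by rw [rx]; linarith]
    exact hR.trans (mul_le_mul_of_nonneg_right hη (abs_nonneg _))
  have hzero : |x - θ₂| ≤ 0 := by nlinarith [abs_nonneg (x - θ₂)]
  refine ⟨m, ?_⟩
  have := abs_nonpos_iff.1 hzero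
  rw [hx] at this
  linarith

/-- The coefficients of the projection of `c` onto the modes proportional to `k`. -/
def projCoeff {n : ℕ} (c : (Fin n → ℤ) → ℂ) (k : Fin n → ℤ) (j : ℤ) : ℂ :=
  if j = 0 then 0 else c (j • k)

lemma projR_eq {n : ℕ} (c : (Fin n → ℤ) → ℂ) (k : Fin n → ℤ) :
    projR c k = fun θ => (trigSeries (projCoeff c k) θ).re := by
  funext θ
  simp only [projR, projC, trigSeries, projCoeff, ite_mul, zero_mul]

lemma norm1_zsmul {n : ℕ} (j : ℤ) (k : Fin n → ℤ) : norm1 (j • k) = j.natAbs * norm1 k := by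
  simp [norm1, Finset.mul_sum, Int.natAbs_mul]

lemma norm1_pos_of_mem_gen {n : ℕ} {k : Fin n → ℤ} (hk : k ∈ gen n) : 0 < norm1 k := by
  obtain ⟨⟨j, hj, -⟩, -⟩ := hk
  refine Finset.sum_pos' (fun _ _ => Nat.zero_le _) ⟨j, Finset.mem_univ _, ?_⟩
  exact Int.natAbs_pos.2 hj.ne'

lemma InBall.norm_le {n : ℕ} {s : ℝ} {c : (Fin n → ℤ) → ℂ} (h : InBall n s c)
    (k : Fin n → ℤ) : ‖c k‖ ≤ Real.exp (-(s * norm1 k)) := by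
  rw [Real.exp_neg, ← one_div, le_div_iff₀ (Real.exp_pos _)]
  exact h.bound k

lemma InBall.norm_projCoeff_le {n : ℕ} {s : ℝ} {c : (Fin n → ℤ) → ℂ} (h : InBall n s c)
    (k : Fin n → ℤ) (j : ℤ) :
    ‖projCoeff c k j‖ ≤ Real.exp (-(s * norm1 k)) ^ j.natAbs := by
  unfold projCoeff
  split_ifs with hj
  · simp only [norm_zero]; positivity
  · refine (h.norm_le _).trans_eq ?_
    rw [norm1_zsmul, ← Real.exp_nat_mul]
    push_cast
    ring_nf

section GeometricCoefficients

variable {a : ℤ → ℂ} {q : ℝ}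

lemma summable_norm_of_geometric (h0 : 0 ≤ q) (h1 : q < 1)
    (ha : ∀ j, ‖a j‖ ≤ q ^ j.natAbs) : Summable fun j => ‖a j‖ :=
  Summable.of_nonneg_of_le (fun _ => norm_nonneg _) ha
    (by simpa using summable_natAbs_pow_mul_geometric 0 h0 h1)

lemma summable_norm_derivCoeff_of_geometric (h0 : 0 ≤ q) (h1 : q < 1)
    (ha : ∀ j, ‖a j‖ ≤ q ^ j.natAbs) : Summable fun j => ‖derivCoeff a j‖ := by
  refine Summable.of_nonneg_of_le (fun _ => norm_nonneg _) (fun j => ?_)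
    (summable_natAbs_pow_mul_geometric 1 h0 h1)
  rw [norm_derivCoeff, pow_one]
  exact mul_le_mul_of_nonneg_left (ha j) (Nat.cast_nonneg _)

lemma summable_norm_derivCoeff_derivCoeff_of_geometric (h0 : 0 ≤ q) (h1 : q < 1)
    (ha : ∀ j, ‖a j‖ ≤ q ^ j.natAbs) :
    Summable fun j => ‖derivCoeff (derivCoeff a) j‖ := by
  refine Summable.of_nonneg_of_le (fun _ => norm_nonneg _) (fun j => ?_)
    (summable_natAbs_pow_mul_geometric 2 h0 h1)
  rw [norm_derivCoeff, norm_derivCoeff, ← mul_assoc, ← sq]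
  exact mul_le_mul_of_nonneg_left (ha j) (by positivity)

lemma continuous_trigSeries (h : Summable fun j => ‖a j‖) : Continuous (trigSeries a) := by
  refine continuous_tsum (u := fun j => ‖a j‖) (fun j => by fun_prop) h fun j θ => ?_
  rw [norm_mul, norm_exp_I_mul_int_mul, mul_one]

lemma exists_betaMorse_re_trigSeries (h0 : 0 ≤ q) (h1 : q < 1)
    (ha : ∀ j, ‖a j‖ ≤ q ^ j.natAbs)
    (hM : MorseWithDistinctValues fun θ => (trigSeries a θ).re) :
    ∃ β, 0 < β ∧ BetaMorse β fun θ => (trigSeries a θ).re := by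
  have s0 := summable_norm_of_geometric h0 h1 ha
  have s1 := summable_norm_derivCoeff_of_geometric h0 h1 ha
  have s2 := summable_norm_derivCoeff_derivCoeff_of_geometric h0 h1 ha
  exact hM.exists_betaMorse (fun θ => hasDerivAt_re (hasDerivAt_trigSeries s0 s1 θ))
    (fun θ => hasDerivAt_re (hasDerivAt_trigSeries s1 s2 θ))
    (Complex.continuous_re.comp (continuous_trigSeries s2))
    ((periodic_trigSeries _).comp _) ((periodic_trigSeries _).comp _)
    ((periodic_trigSeries _).comp _)

lemma hasSum_half_pow_natAbs : HasSum (fun j : ℤ => (1 / 2 : ℝ) ^ j.natAbs) (2 + 1 / 2 * 2) := by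
  refine HasSum.of_nat_of_neg_add_one ?_ ?_
  · simpa only [Int.natAbs_natCast] using hasSum_geometric_two
  · have h : ∀ m : ℕ, (-((m : ℤ) + 1)).natAbs = m + 1 := fun m => by omega
    simpa only [h, pow_succ'] using hasSum_geometric_two.mul_left (1 / 2 : ℝ)

/-- If the first harmonic dominates the square of the geometric rate, the trigonometric series is
close to a shifted cosine. -/
lemma morseWithDistinctValues_re_trigSeries (h0 : 0 ≤ q) (hq : q ≤ 1 / 2 ^ 44)
    (ha : ∀ j, ‖a j‖ ≤ q ^ j.natAbs) (hzero : a 0 = 0)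
    (hconj : a (-1) = (starRingEnd ℂ) (a 1)) (hpos : 0 < ‖a 1‖)
    (hdom : q ^ 2 ≤ ‖a 1‖ / 2 ^ 44) :
    MorseWithDistinctValues fun θ => (trigSeries a θ).re := by
  have hq1 : q < 1 := hq.trans_lt (by norm_num)
  set b : ℤ → ℂ := fun j => if j.natAbs ≤ 1 then 0 else a j with hb
  have hba : ∀ j, ‖b j‖ ≤ q ^ j.natAbs := by
    intro j
    simp only [hb]
    split_ifs
    · simp only [norm_zero]; positivity
    · exact ha j
  have s0 := summable_norm_of_geometric h0 hq1 hba
  have s1 := summable_norm_derivCoeff_of_geometric h0 hq1 hba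
  have s2 := summable_norm_derivCoeff_derivCoeff_of_geometric h0 hq1 hba
  have hsum := hasSum_half_pow_natAbs.summable
  have hbig : ∀ j, (j.natAbs : ℝ) ^ 2 * ‖b j‖ ≤ 64 * q ^ 2 * (1 / 2) ^ j.natAbs := by
    intro j
    simp only [hb]
    split_ifs with hj
    · simp only [norm_zero, mul_zero]; positivity
    obtain ⟨m, hm⟩ : ∃ m, j.natAbs = m + 2 := ⟨j.natAbs - 2, by omega⟩
    have h3 : (j.natAbs : ℝ) ^ 2 ≤ 4 ^ j.natAbs := by
      have : (j.natAbs : ℝ) ≤ 2 ^ j.natAbs := by exact_mod_cast Nat.lt_two_pow_self.le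
      calc (j.natAbs : ℝ) ^ 2 ≤ (2 ^ j.natAbs) ^ 2 := by gcongr
        _ = 4 ^ j.natAbs := by rw [← pow_mul, mul_comm, pow_mul]; norm_num
    calc (j.natAbs : ℝ) ^ 2 * ‖a j‖ ≤ 4 ^ j.natAbs * q ^ j.natAbs := by gcongr; exact ha j
      _ = 16 * q ^ 2 * (4 * q) ^ m := by rw [hm]; ring
      _ ≤ 16 * q ^ 2 * (1 / 2) ^ m := by
          gcongr
          linarith [hq, show (4 : ℝ) * (1 / 2 ^ 44) ≤ 1 / 2 by norm_num]
      _ = 64 * q ^ 2 * (1 / 2) ^ j.natAbs := by rw [hm]; ring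
  have hsum' := hsum.mul_left (64 * q ^ 2)
  have htot : ∑' j : ℤ, 64 * q ^ 2 * (1 / 2 : ℝ) ^ j.natAbs ≤ 2 * ‖a 1‖ / 100 := by
    rw [tsum_mul_left, hasSum_half_pow_natAbs.tsum_eq]
    linarith
  have hweak : ∀ j, ‖b j‖ ≤ ‖derivCoeff b j‖ ∧
      ‖derivCoeff b j‖ ≤ ‖derivCoeff (derivCoeff b) j‖ ∧
      ‖derivCoeff (derivCoeff b) j‖ ≤ 64 * q ^ 2 * (1 / 2) ^ j.natAbs := by
    intro j
    have h3 := hbig j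
    simp only [norm_derivCoeff, ← mul_assoc, ← sq]
    by_cases hj : j.natAbs ≤ 1
    · have : b j = 0 := by simp [hb, hj]
      simp only [this, norm_zero, mul_zero, le_refl, true_and]
      positivity
    · have h4 : (1 : ℝ) ≤ j.natAbs := by exact_mod_cast (by omega : 1 ≤ j.natAbs)
      refine ⟨le_mul_of_one_le_left (norm_nonneg _) h4, ?_, h3⟩
      exact mul_le_mul_of_nonneg_right (by nlinarith) (norm_nonneg _)
  have habs : ∀ {d : ℤ → ℂ}, (∀ j, ‖d j‖ ≤ 64 * q ^ 2 * (1 / 2) ^ j.natAbs) → ∀ θ,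
      |(trigSeries d θ).re| ≤ ∑' j : ℤ, 64 * q ^ 2 * (1 / 2 : ℝ) ^ j.natAbs :=
    fun hd θ => (Complex.abs_re_le_norm _).trans (norm_trigSeries_le hsum' hd θ)
  refine morseWithDistinctValues_of_near_cos (A := 2 * ‖a 1‖) (φ := (a 1).arg)
    (by positivity) htot
    (fun θ => hasDerivAt_re (hasDerivAt_trigSeries s0 s1 θ))
    (fun θ => hasDerivAt_re (hasDerivAt_trigSeries s1 s2 θ))
    ((periodic_trigSeries _).comp _)
    (habs fun j => (hweak j).1.trans ((hweak j).2.1.trans (hweak j).2.2))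
    (habs fun j => (hweak j).2.1.trans (hweak j).2.2)
    (habs fun j => (hweak j).2.2) (fun θ => ?_)
  have hsplit : trigSeries a θ =
      (a 1 * Complex.exp (I * θ) + (starRingEnd ℂ) (a 1 * Complex.exp (I * θ)))
        + trigSeries b θ := by
    have hbs : Summable fun j : ℤ => b j * Complex.exp (I * j * θ) :=
      Summable.of_norm (s0.congr fun j => by
        rw [norm_mul, norm_exp_I_mul_int_mul, mul_one])
    have hfs : HasSum (fun j : ℤ => (a j - b j) * Complex.exp (I * j * θ))
        (∑ j ∈ ({1, -1} : Finset ℤ), (a j - b j) * Complex.exp (I * j * θ)) := by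
      refine hasSum_sum_of_ne_finset_zero fun j hj => ?_
      simp only [Finset.mem_insert, Finset.mem_singleton, not_or] at hj
      rcases eq_or_ne j 0 with rfl | hj0
      · simp [hb, hzero]
      · have : ¬ j.natAbs ≤ 1 := by omega
        simp [hb, this]
    have h3 := (hfs.add hbs.hasSum).tsum_eq
    rw [Finset.sum_pair (by norm_num)] at h3
    rw [trigSeries, trigSeries]
    convert h3 using 1
    · exact tsum_congr fun j => by ring
    · congr 2
      · simp [hb]
      · simp [hb, hconj, ← Complex.exp_conj]
  rw [hsplit, Complex.add_re, Complex.add_conj]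
  congr 1
  conv_lhs => rw [← Complex.norm_mul_exp_arg_mul_I (a 1)]
  rw [mul_assoc, ← Complex.exp_add,
    show ((a 1).arg : ℂ) * I + I * θ = ((θ + (a 1).arg : ℝ) : ℂ) * I by push_cast; ring]
  rw [Complex.ofReal_re, Complex.re_ofReal_mul, Complex.exp_ofReal_mul_I_re]
  ring

end GeometricCoefficients

lemma pow_mul_exp_neg_half_le (n : ℕ) (hn : 1 ≤ n) {x : ℝ} (hx : 0 ≤ x) :
    x ^ n * Real.exp (-(x / 2)) ≤ (2 * (n : ℝ) / Real.exp 1) ^ n := by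
  have hn' : (0 : ℝ) < n := by exact_mod_cast hn
  have h := Real.add_one_le_exp (x / (2 * n) - 1)
  have h3 : x ≤ 2 * n / Real.exp 1 * Real.exp (x / (2 * n)) := by
    rw [Real.exp_sub, sub_add_cancel, div_le_iff₀ (by positivity)] at h
    calc x ≤ _ := h
      _ = _ := by ring
  calc x ^ n * Real.exp (-(x / 2))
      ≤ (2 * n / Real.exp 1 * Real.exp (x / (2 * n))) ^ n * Real.exp (-(x / 2)) := by gcongr
    _ = (2 * (n : ℝ) / Real.exp 1) ^ n := by
        rw [mul_pow, ← Real.exp_nat_mul, mul_assoc, ← Real.exp_add,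
          show (n : ℝ) * (x / (2 * n)) + -(x / 2) = 0 by field_simp; ring]
        simp

/-- Beyond the cut-off the factor `Kⁿ e^{-sK}` is far below `δ`. -/
lemma pow_mul_exp_neg_le_of_Ncut_le {n : ℕ} (hn : 1 ≤ n) {s δ K : ℝ} (hs : 0 < s) (hδ : 0 < δ)
    (hK : Ncut n s δ ≤ K) : K ^ n * Real.exp (-(s * K)) ≤ δ / 2 ^ 44 := by
  have hn' : (0 : ℝ) < n := by exact_mod_cast hn
  set M : ℝ := (2 * (n : ℝ) / Real.exp 1) ^ n with hM
  have hMpos : 0 < M := by positivity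
  have hK2 : 2 ≤ K := by
    refine le_trans ?_ hK
    unfold Ncut
    linarith [le_max_left 1 (1 / s * Real.log (2 ^ 44 * M / (s ^ n * δ)))]
  have hlog : Real.log (2 ^ 44 * M / (s ^ n * δ)) ≤ s * K / 2 := by
    have h := le_max_right 1 (1 / s * Real.log (2 ^ 44 * M / (s ^ n * δ)))
    have h3 : 2 * (1 / s * Real.log (2 ^ 44 * M / (s ^ n * δ))) ≤ K := by
      refine le_trans ?_ hK
      unfold Ncut
      linarith
    calc Real.log (2 ^ 44 * M / (s ^ n * δ))
        = s / 2 * (2 * (1 / s * Real.log (2 ^ 44 * M / (s ^ n * δ)))) := by field_simp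
      _ ≤ s / 2 * K := by gcongr
      _ = s * K / 2 := by ring
  have h1 : Real.exp (-(s * K / 2)) ≤ s ^ n * δ / (2 ^ 44 * M) := by
    rw [Real.exp_neg, ← inv_div (2 ^ 44 * M)]
    refine inv_anti₀ (by positivity) ?_
    rwa [← Real.log_le_iff_le_exp (by positivity)]
  have h2 := pow_mul_exp_neg_half_le n hn (x := s * K) (by positivity)
  rw [← hM] at h2
  have h3 : K ^ n * Real.exp (-(s * K / 2)) ≤ M / s ^ n := by
    rw [le_div_iff₀ (by positivity)]
    calc _ = (s * K) ^ n * Real.exp (-(s * K / 2)) := by rw [mul_pow]; ring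
      _ ≤ M := h2
  calc K ^ n * Real.exp (-(s * K))
      = (K ^ n * Real.exp (-(s * K / 2))) * Real.exp (-(s * K / 2)) := by
        rw [mul_assoc, ← Real.exp_add]; ring_nf
    _ ≤ (M / s ^ n) * (s ^ n * δ / (2 ^ 44 * M)) := by gcongr
    _ = δ / 2 ^ 44 := by field_simp

/-- Projections on generators beyond the cut-off are Morse with distinct critical values. -/
lemma P1plus.morseWithDistinctValues_projR {n : ℕ} (hn : 1 ≤ n) {s δ : ℝ} (hs : 0 < s)
    (hδ : δ ∈ Set.Ioc (0 : ℝ) 1) {c : (Fin n → ℤ) → ℂ} (hc : InBall n s c)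
    (hP : P1plus n s δ c) {k : Fin n → ℤ} (hk : k ∈ gen n)
    (hkN : Ncut n s δ ≤ (norm1 k : ℝ)) : MorseWithDistinctValues (projR c k) := by
  have hK : (1 : ℝ) ≤ norm1 k := by exact_mod_cast norm1_pos_of_mem_gen hk
  have hKn : (1 : ℝ) ≤ (norm1 k : ℝ) ^ n := one_le_pow₀ hK
  have hmain := pow_mul_exp_neg_le_of_Ncut_le hn hs hδ.1 hkN
  have hlow := hP k hk hkN
  have hδ0 := hδ.1
  have hca : projCoeff c k 1 = c k := by simp [projCoeff]
  have hlow0 : 0 < δ / (norm1 k : ℝ) ^ n * Real.exp (-(s * norm1 k)) := by positivity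
  set q := Real.exp (-(s * norm1 k)) with hq
  have hq0 : 0 < q := Real.exp_pos _
  rw [projR_eq]
  refine morseWithDistinctValues_re_trigSeries hq0.le ?_ (hc.norm_projCoeff_le k)
    (by simp [projCoeff]) (by simp [projCoeff, hc.real]) ?_ ?_
  · have := hδ.2
    calc q ≤ (norm1 k : ℝ) ^ n * q := le_mul_of_one_le_left hq0.le hKn
      _ ≤ δ / 2 ^ 44 := hmain
      _ ≤ 1 / 2 ^ 44 := by gcongr
  · rw [hca]
    exact hlow0.trans_le hlow
  · rw [hca]
    calc q ^ 2 = (norm1 k : ℝ) ^ n * q * q / (norm1 k : ℝ) ^ n := by field_simp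
      _ ≤ δ / 2 ^ 44 * q / (norm1 k : ℝ) ^ n := by gcongr
      _ = (δ / (norm1 k : ℝ) ^ n * q) / 2 ^ 44 := by ring
      _ ≤ ‖c k‖ / 2 ^ 44 := by gcongr

lemma finite_genK (n : ℕ) (K : ℝ) : (genK n K).Finite := by
  obtain ⟨m, hm⟩ := exists_nat_ge K
  refine (Set.finite_Icc (fun _ => -(m : ℤ)) (fun _ => (m : ℤ)) :
    (Set.Icc (fun _ : Fin n => -(m : ℤ)) (fun _ => (m : ℤ))).Finite).subset fun k hk => ?_
  have h : norm1 k ≤ m := by exact_mod_cast hk.2.trans hm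
  have h3 : ∀ i, (k i).natAbs ≤ m := fun i =>
    (Finset.single_le_sum (f := fun i => (k i).natAbs) (fun _ _ => Nat.zero_le _)
      (Finset.mem_univ i)).trans h
  exact ⟨fun i => by have := h3 i; simp only; omega, fun i => by have := h3 i; simp only; omega⟩

lemma BetaMorse.mono {β β' : ℝ} {F : ℝ → ℝ} (h : BetaMorse β F) (hβ : β' ≤ β) :
    BetaMorse β' F :=
  ⟨fun θ => hβ.trans (h.1 θ), fun θ₁ θ₂ h1 h2 h3 => hβ.trans (h.2 θ₁ θ₂ h1 h2 h3)⟩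

lemma BetaMorse.morseWithDistinctValues {β : ℝ} {F : ℝ → ℝ} (h : BetaMorse β F) (hβ : 0 < β) :
    MorseWithDistinctValues F := by
  refine ⟨fun θ h1 h2 => ?_, fun θ₁ θ₂ h1 h2 hv => ?_⟩
  · have := h.1 θ
    simp only [h1, h2, abs_zero, add_zero] at this
    linarith
  · by_contra hne
    have := h.2 θ₁ θ₂ h1 h2 hne
    simp only [hv, sub_self, abs_zero] at this
    linarith

lemma tendsto_Ncut {n : ℕ} (hn : 1 ≤ n) {s : ℝ} (hs : 0 < s) :
    Filter.Tendsto (Ncut n s) (nhdsWithin 0 (Set.Ioi 0)) Filter.atTop := by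
  have hn' : (0 : ℝ) < n := by exact_mod_cast hn
  set M : ℝ := 2 ^ 44 * (2 * (n : ℝ) / Real.exp 1) ^ n with hM
  have hMpos : 0 < M := by positivity
  have h1 : Filter.Tendsto (fun δ : ℝ => M / (s ^ n * δ)) (nhdsWithin 0 (Set.Ioi 0))
      Filter.atTop := by
    refine (tendsto_inv_nhdsGT_zero.const_mul_atTop
      (show 0 < M / s ^ n by positivity)).congr fun δ => ?_
    rw [div_mul_eq_div_div, div_eq_mul_inv (M / s ^ n)]
  have h2 := ((Real.tendsto_log_atTop.comp h1).const_mul_atTop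
    (show 0 < 1 / s by positivity)).const_mul_atTop (two_pos (α := ℝ))
  refine Filter.tendsto_atTop_mono (fun δ => ?_) h2
  exact mul_le_mul_of_nonneg_left (le_max_right _ _) two_pos.le

theorem stmt_3 (n : ℕ) (hn : 1 ≤ n) (s : ℝ) (hs : 0 < s) :
    Gset n s = ⋃ δ ∈ Set.Ioc (0:ℝ) 1, ⋃ β ∈ Set.Ioi (0:ℝ), GsetDB n s δ β := by
  ext c
  simp only [Set.mem_iUnion, exists_prop]
  constructor
  · rintro ⟨hc, ⟨d, hd, N, hN⟩, hM⟩
    obtain ⟨δ, hδN, hδ⟩ : ∃ δ, N ≤ Ncut n s δ ∧ δ ∈ Set.Ioo 0 (min 1 d) :=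
      (((tendsto_Ncut hn hs).eventually_ge_atTop N).and
        (Ioo_mem_nhdsGT (lt_min one_pos hd))).exists
    have hδ1 : δ ≤ 1 := hδ.2.le.trans (min_le_left _ _)
    have hδd : δ ≤ d := hδ.2.le.trans (min_le_right _ _)
    have hβ : ∀ k ∈ genK n (Ncut n s δ), ∃ β, 0 < β ∧ BetaMorse β (projR c k) := by
      rintro k ⟨hk, -⟩
      have hq : Real.exp (-(s * norm1 k)) < 1 := by
        rw [Real.exp_lt_one_iff]
        have : (0 : ℝ) < norm1 k := by exact_mod_cast norm1_pos_of_mem_gen hk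
        have := mul_pos hs this
        linarith
      have h := hM k hk
      rw [projR_eq] at h ⊢
      exact exists_betaMorse_re_trigSeries (Real.exp_pos _).le hq (hc.norm_projCoeff_le k) h
    choose! b hb0 hb using hβ
    obtain ⟨β, hβ0, hβ⟩ : ∃ β : ℝ, 0 < β ∧ ∀ k ∈ genK n (Ncut n s δ), β ≤ b k := by
      rcases (genK n (Ncut n s δ)).eq_empty_or_nonempty with h | h
      · exact ⟨1, one_pos, by simp [h]⟩
      · obtain ⟨k, hk, hmin⟩ := Set.exists_min_image _ b (finite_genK n _) h
        exact ⟨b k, hb0 k hk, hmin⟩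
    refine ⟨δ, ⟨hδ.1, hδ1⟩, β, hβ0, hc, fun k hk hkN => ?_, fun k hk hkN =>
      (hb k ⟨hk, hkN⟩).mono (hβ k ⟨hk, hkN⟩)⟩
    have h := hδd.trans (hN k hk (hδN.trans hkN))
    have hK : (0 : ℝ) < norm1 k := by exact_mod_cast norm1_pos_of_mem_gen hk
    rw [Real.exp_neg, ← div_eq_mul_inv, div_div, div_le_iff₀ (by positivity)]
    linarith
  · rintro ⟨δ, hδ, β, hβ, hc, hP, hB⟩
    refine ⟨hc, ⟨δ, hδ.1, Ncut n s δ, fun k hk hkN => ?_⟩, fun k hk => ?_⟩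
    · have h := hP k hk hkN
      have hK : (0 : ℝ) < norm1 k := by exact_mod_cast norm1_pos_of_mem_gen hk
      rw [Real.exp_neg, ← div_eq_mul_inv, div_div, div_le_iff₀ (by positivity)] at h
      linarith
    · rcases le_total (norm1 k : ℝ) (Ncut n s δ) with h | h
      · exact (hB k hk h).morseWithDistinctValues hβ
      · exact hP.morseWithDistinctValues_projR hn hs hδ hc hk h

end
end

section
/- Let F(θ) = Σ_{j∈Z} F_j e^{ijθ} be a real analytic real-valued function on T. Then there exists a compact set Γ⊆C of zero Lebesgue measure, depending only on the Fourier coefficients F_j with |j|≥2, such that whenever the Fourier coefficient F_1 does not belong to Γ, the function F is a Morse function with distinct critical values (i.e., all critical points of F are nondegenerate and distinct critical points have distinct critical values). -/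
noncomputable section
open Complex

/-- The real analytic function on the torus with Fourier coefficients `b j` for `j ≠ ±1`,
and with first Fourier coefficient `z` (so `F_{-1} = conj z` by reality). -/
def Fone (b : ℤ → ℂ) (z : ℂ) (θ : ℝ) : ℝ :=
  (∑' j : ℤ, (if j = 1 then z else if j = -1 then (starRingEnd ℂ) z else b j) *
      Complex.exp (Complex.I * (j : ℂ) * (θ : ℂ))).re

/-- The real function `G` with the first Fourier mode `2 Re (z e^{iθ})` added. -/
def addFirstMode (G : ℝ → ℝ) (z : ℂ) (θ : ℝ) : ℝ := G θ + 2 * (z * exp (I * θ)).re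

section FirstMode

variable {G : ℝ → ℝ} {z : ℂ}

theorem norm_exp_I_mul (θ : ℝ) : ‖exp (I * θ)‖ = 1 := by
  rw [mul_comm, norm_exp_ofReal_mul_I]

theorem norm_exp_I_mul_sub_le (x y : ℝ) : ‖exp (I * x) - exp (I * y)‖ ≤ |x - y| := by
  have h : exp (I * x) - exp (I * y) = exp (I * y) * (exp (I * (x - y : ℝ)) - 1) := by
    rw [mul_sub, mul_one, ← exp_add]
    push_cast
    ring_nf
  rw [h, norm_mul, norm_exp_I_mul, one_mul]
  exact Real.norm_exp_I_mul_ofReal_sub_one_le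

theorem hasDerivAt_exp_I_mul (θ : ℝ) :
    HasDerivAt (fun x : ℝ => exp (I * x)) (I * exp (I * θ)) θ := by
  have h := ((ofRealCLM.hasDerivAt (x := θ)).const_mul I).cexp
  simpa [mul_comm] using h

theorem deriv_addFirstMode (hG : Differentiable ℝ G) (z : ℂ) :
    deriv (addFirstMode G z) = addFirstMode (deriv G) (I * z) := by
  ext θ
  have h := (hasDerivAt_exp_I_mul θ).const_mul z
  have h' := (reCLM.hasFDerivAt.comp_hasDerivAt θ h).const_mul 2
  have h'' := ((hG θ).hasDerivAt.add h').deriv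
  rw [show addFirstMode G z = G + fun θ : ℝ => 2 * (z * exp (I * θ)).re from rfl]
  refine h''.trans ?_
  simp only [addFirstMode, reCLM_apply]
  ring_nf

theorem contDiff_addFirstMode {n : WithTop ℕ∞} (hG : ContDiff ℝ n G) :
    ContDiff ℝ n (fun p : ℂ × ℝ => addFirstMode G p.1 p.2) := by
  have h : ContDiff ℝ n (fun p : ℂ × ℝ => p.1 * exp (I * p.2)) :=
    contDiff_fst.mul (contDiff_const.mul (ofRealCLM.contDiff.comp contDiff_snd)).cexp
  exact (hG.comp contDiff_snd).add (contDiff_const.mul (reCLM.contDiff.comp h))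

theorem contDiff_addFirstMode_apply {n : WithTop ℕ∞} (hG : ContDiff ℝ n G) (z : ℂ) :
    ContDiff ℝ n (addFirstMode G z) :=
  (contDiff_addFirstMode hG).comp (contDiff_const.prodMk contDiff_id)

theorem periodic_addFirstMode (hG : Function.Periodic G (2 * Real.pi)) (z : ℂ) :
    Function.Periodic (addFirstMode G z) (2 * Real.pi) := by
  intro θ
  have h : exp (I * (θ + 2 * Real.pi : ℝ)) = exp (I * θ) := by
    rw [← exp_periodic (I * θ)]
    push_cast
    ring_nf
  simp only [addFirstMode, hG θ, h]

theorem addFirstMode_sub (G : ℝ → ℝ) (w z : ℂ) (θ : ℝ) :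
    addFirstMode G w θ - addFirstMode G z θ = 2 * ((w - z) * exp (I * θ)).re := by
  simp only [addFirstMode, sub_mul, sub_re]
  ring

theorem Function.Periodic.deriv_periodic {f : ℝ → ℝ} {c : ℝ} (hf : Function.Periodic f c) :
    Function.Periodic (deriv f) c := by
  intro x
  rw [← deriv_comp_add_const, funext hf]

theorem exists_mem_uIcc_sub_eq_deriv_mul {f : ℝ → ℝ} (hf : Differentiable ℝ f) (a b : ℝ) :
    ∃ c ∈ Set.uIcc a b, f b - f a = deriv f c * (b - a) := by
  rcases lt_trichotomy a b with h | rfl | h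
  · obtain ⟨c, hc, h'⟩ := exists_deriv_eq_slope f h hf.continuous.continuousOn hf.differentiableOn
    refine ⟨c, Set.Icc_subset_uIcc (Set.Ioo_subset_Icc_self hc), ?_⟩
    rw [h', div_mul_cancel₀ _ (sub_ne_zero.2 h.ne')]
  · exact ⟨a, by simp, by simp⟩
  · obtain ⟨c, hc, h'⟩ := exists_deriv_eq_slope f h hf.continuous.continuousOn hf.differentiableOn
    refine ⟨c, Set.Icc_subset_uIcc' (Set.Ioo_subset_Icc_self hc), ?_⟩
    rw [h', div_mul_eq_mul_div, eq_div_iff (sub_ne_zero.2 h.ne')]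
    ring

/-- To first order, a critical value which stays in an interval where the second derivative does
not vanish changes with `z` as if the critical point did not move. -/
theorem exists_critical_value_estimate (hG : ContDiff ℝ 2 G) {a b θ : ℝ} (hθ : θ ∈ Set.Icc a b)
    (hcrit : deriv (addFirstMode G z) θ = 0)
    (hnd : ∀ x ∈ Set.Icc a b, deriv (deriv (addFirstMode G z)) x ≠ 0) :
    ∃ C : ℝ, ∀ w : ℂ, ∀ x ∈ Set.Icc a b, deriv (addFirstMode G w) x = 0 →
      |addFirstMode G w x - addFirstMode G z θ - 2 * ((w - z) * exp (I * θ)).re| ≤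
        C * ‖w - z‖ ^ 2 := by
  have hF := contDiff_addFirstMode_apply hG z
  have hF1 : ContDiff ℝ 1 (deriv (addFirstMode G z)) := by
    have h : ContDiff ℝ (1 + 1) (addFirstMode G z) := by simpa [one_add_one_eq_two] using hF
    exact (contDiff_succ_iff_deriv.1 h).2.2
  have hF2 : Continuous (deriv (deriv (addFirstMode G z))) := hF1.continuous_deriv le_rfl
  have hd : Differentiable ℝ (addFirstMode G z) := hF.differentiable (by norm_num)
  have hd1 : Differentiable ℝ (deriv (addFirstMode G z)) := hF1.differentiable (by norm_num)
  have hdG : Differentiable ℝ G := hG.differentiable (by norm_num)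
  obtain ⟨x₀, hx₀, hmin⟩ := isCompact_Icc.exists_isMinOn ⟨θ, hθ⟩ hF2.abs.continuousOn
  obtain ⟨M, hM⟩ := isCompact_Icc.exists_bound_of_continuousOn (s := Set.Icc a b) hF2.continuousOn
  set c := |deriv (deriv (addFirstMode G z)) x₀|
  have hcpos : 0 < c := abs_pos.2 (hnd x₀ hx₀)
  have hM0 : 0 ≤ M := (norm_nonneg _).trans (hM θ hθ)
  refine ⟨M * (2 / c) ^ 2 + 2 * (2 / c), fun w x hx hwx => ?_⟩
  have hsub : Set.uIcc θ x ⊆ Set.Icc a b := Set.ordConnected_Icc.uIcc_subset hθ hx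
  have hgrad : |deriv (addFirstMode G z) x| ≤ 2 * ‖w - z‖ := by
    have h := addFirstMode_sub (deriv G) (I * w) (I * z) x
    rw [← deriv_addFirstMode hdG, ← deriv_addFirstMode hdG, hwx, zero_sub] at h
    rw [← abs_neg, h, abs_mul, abs_two]
    gcongr
    refine (abs_re_le_norm _).trans ?_
    rw [norm_mul, norm_exp_I_mul, ← mul_sub, norm_mul, norm_I]
    simp
  have hmove : |x - θ| ≤ 2 / c * ‖w - z‖ := by
    obtain ⟨y, hy, h⟩ := exists_mem_uIcc_sub_eq_deriv_mul hd1 θ x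
    rw [hcrit, sub_zero] at h
    rw [h, abs_mul] at hgrad
    have h' : c ≤ |deriv (deriv (addFirstMode G z)) y| := hmin (hsub hy)
    rw [div_mul_eq_mul_div, le_div_iff₀ hcpos, mul_comm]
    exact (mul_le_mul_of_nonneg_right h' (abs_nonneg _)).trans hgrad
  have hval : |addFirstMode G z x - addFirstMode G z θ| ≤ M * |x - θ| ^ 2 := by
    obtain ⟨y, hy, h⟩ := exists_mem_uIcc_sub_eq_deriv_mul hd θ x
    obtain ⟨u, hu, h'⟩ := exists_mem_uIcc_sub_eq_deriv_mul hd1 θ y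
    rw [hcrit, sub_zero] at h'
    have hu' : u ∈ Set.Icc a b := Set.ordConnected_Icc.uIcc_subset hθ (hsub hy) hu
    have hyx : |y - θ| ≤ |x - θ| := Set.abs_sub_left_of_mem_uIcc hy
    rw [h, h', abs_mul, abs_mul, sq, ← mul_assoc]
    gcongr
    exact hM u hu'
  have hosc : |2 * ((w - z) * (exp (I * x) - exp (I * θ))).re| ≤ 2 * (‖w - z‖ * |x - θ|) := by
    rw [abs_mul, abs_two]
    gcongr
    refine (abs_re_le_norm _).trans ?_
    rw [norm_mul]
    gcongr
    exact norm_exp_I_mul_sub_le x θ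
  have hsplit : addFirstMode G w x - addFirstMode G z θ - 2 * ((w - z) * exp (I * θ)).re =
      (addFirstMode G z x - addFirstMode G z θ) +
        2 * ((w - z) * (exp (I * x) - exp (I * θ))).re := by
    have h := addFirstMode_sub G w z x
    rw [mul_sub (w - z), sub_re]
    linarith
  rw [hsplit]
  calc _ ≤ M * |x - θ| ^ 2 + 2 * (‖w - z‖ * |x - θ|) := (abs_add_le _ _).trans (add_le_add hval hosc)
    _ ≤ M * (2 / c * ‖w - z‖) ^ 2 + 2 * (‖w - z‖ * (2 / c * ‖w - z‖)) := by gcongr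
    _ = _ := by ring

end FirstMode

section NullSets

theorem ContinuousLinearMap.det_eq_zero_of_apply_eq_zero {A : ℂ →L[ℝ] ℂ} {v : ℂ} (hv : v ≠ 0)
    (h : A v = 0) : A.det = 0 := by
  rw [ContinuousLinearMap.det, LinearMap.det_eq_zero_iff_ker_ne_bot, Submodule.ne_bot_iff]
  exact ⟨v, h, hv⟩

/-- A plane set which is contained near each of its points in a thin neighbourhood of a line
through that point is a null set. -/
theorem volume_eq_zero_of_thin {S : Set ℂ}
    (hS : ∀ z ∈ S, ∃ u : ℂ, u ≠ 0 ∧ ∃ C : ℝ, ∀ w ∈ S, |((w - z) * u).re| ≤ C * ‖w - z‖ ^ 2) :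
    MeasureTheory.volume S = 0 := by
  have key : ∀ z ∈ S, ∃ A : ℂ →L[ℝ] ℂ, HasFDerivWithinAt id A S z ∧ A.det = 0 := by
    intro z hz
    obtain ⟨u, hu, C, hC⟩ := hS z hz
    have hn : normSq u ≠ 0 := by simpa using hu
    let R : ℂ →L[ℝ] ℝ := reCLM.comp ((ContinuousLinearMap.mul ℝ ℂ).flip u)
    let v : ℂ := (normSq u : ℂ)⁻¹ * (starRingEnd ℂ) u
    have hR : ∀ h, R h = (h * u).re := fun h => rfl
    have hvu : v * u = 1 := by
      simp only [v]
      rw [mul_assoc, mul_comm _ u, mul_conj, inv_mul_cancel₀ (by exact_mod_cast hn)]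
    have hv : v ≠ 0 := by
      rintro h
      simp [h] at hvu
    refine ⟨ContinuousLinearMap.id ℝ ℂ - R.smulRight v, ?_,
      ContinuousLinearMap.det_eq_zero_of_apply_eq_zero hv ?_⟩
    · rw [hasFDerivWithinAt_iff_isLittleO]
      have hO : (fun w => id w - id z - (ContinuousLinearMap.id ℝ ℂ - R.smulRight v) (w - z))
          =O[nhdsWithin z S] fun w => ‖w - z‖ ^ 2 := by
        refine Asymptotics.IsBigO.of_bound (C * ‖v‖) ?_
        filter_upwards [self_mem_nhdsWithin] with w hw
        have h := hC w hw
        have h' : id w - id z - (ContinuousLinearMap.id ℝ ℂ - R.smulRight v) (w - z) =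
            R (w - z) • v := by simp
        rw [h', norm_smul, hR, Real.norm_eq_abs, norm_pow, norm_norm]
        calc _ ≤ C * ‖w - z‖ ^ 2 * ‖v‖ := by gcongr
          _ = _ := by ring
      refine hO.trans_isLittleO ?_
      have h0 : Filter.Tendsto (fun w => w - z) (nhdsWithin z S) (nhds 0) := by
        have : Filter.Tendsto (fun w => w - z) (nhds z) (nhds (z - z)) :=
          (continuous_id.sub continuous_const).tendsto z
        rw [sub_self] at this
        exact this.mono_left nhdsWithin_le_nhds
      exact (Asymptotics.isLittleO_norm_pow_id one_lt_two).comp_tendsto h0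
    · simp [hR, hvu]
  choose! A hA hdet using key
  simpa using MeasureTheory.addHaar_image_eq_zero_of_det_fderivWithin_eq_zero
    MeasureTheory.volume hA hdet

theorem volume_range_eq_zero_of_differentiable {γ : ℝ → ℂ} (hγ : Differentiable ℝ γ) :
    MeasureTheory.volume (Set.range γ) = 0 := by
  have h := MeasureTheory.addHaar_image_eq_zero_of_det_fderivWithin_eq_zero
    (MeasureTheory.volume : MeasureTheory.Measure ℂ) (s := Set.univ) (f := γ ∘ re)
    (f' := fun w => (fderiv ℝ γ w.re).comp reCLM)
    (fun w _ => ((hγ _).hasFDerivAt.comp w reCLM.hasFDerivAt).hasFDerivWithinAt)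
    (fun w _ => ContinuousLinearMap.det_eq_zero_of_apply_eq_zero I_ne_zero (by simp))
  rwa [Set.image_univ, Set.range_comp, Set.range_eq_univ.2 re_surjective, Set.image_univ] at h

end NullSets

section ExceptionalSet

variable {G : ℝ → ℝ} {z : ℂ}

/-- The parameters `z` for which `G` with first mode `z` added has a degenerate critical point
(`δ = 0`) or two critical points at distance `δ` with the same value. The vanishing of the second
derivative at `θ + ξ`, automatic by Rolle's theorem for `0 < δ`, makes the condition closed. -/
def exceptionalParameters (G : ℝ → ℝ) : Set ℂ :=
  {z | ∃ θ ∈ Set.Icc 0 (2 * Real.pi), ∃ δ ∈ Set.Icc 0 Real.pi, ∃ ξ ∈ Set.Icc 0 δ,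
    deriv (addFirstMode G z) θ = 0 ∧ deriv (addFirstMode G z) (θ + δ) = 0 ∧
    addFirstMode G z θ = addFirstMode G z (θ + δ) ∧
    deriv (deriv (addFirstMode G z)) (θ + ξ) = 0}

theorem deriv_deriv_addFirstMode (hG : Differentiable ℝ G) (hG' : Differentiable ℝ (deriv G))
    (z : ℂ) : deriv (deriv (addFirstMode G z)) = addFirstMode (deriv (deriv G)) (I * (I * z)) := by
  rw [deriv_addFirstMode hG, deriv_addFirstMode hG']

theorem two_div_pi_mul_le_norm_exp_sub_one {δ : ℝ} (hδ : δ ∈ Set.Icc 0 Real.pi) :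
    2 / Real.pi * δ ≤ ‖exp (I * δ) - 1‖ := by
  rw [norm_exp_I_mul_ofReal_sub_one]
  refine le_trans ?_ (le_abs_self _)
  have h := Real.mul_le_sin (x := δ / 2) (by linarith [hδ.1]) (by linarith [hδ.2])
  linarith

theorem Function.Periodic.exists_abs_le {f : ℝ → ℝ} {c : ℝ} (hf : Function.Periodic f c)
    (hc : c ≠ 0) (hcont : Continuous f) : ∃ M, ∀ x, |f x| ≤ M := by
  obtain ⟨M, hM⟩ := (hf.isBounded_of_continuous hc hcont).exists_norm_le
  exact ⟨M, fun x => hM _ ⟨x, rfl⟩⟩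

theorem contDiff_one_deriv (hG : ContDiff ℝ 2 G) : ContDiff ℝ 1 (deriv G) := by
  have h : ContDiff ℝ (1 + 1) G := by simpa [one_add_one_eq_two] using hG
  exact (contDiff_succ_iff_deriv.1 h).2.2

theorem exists_norm_le_of_mem_exceptionalParameters (hG : ContDiff ℝ 2 G)
    (hper : Function.Periodic G (2 * Real.pi)) :
    ∃ R : ℝ, ∀ z ∈ exceptionalParameters G, ‖z‖ ≤ R := by
  have hG1 := contDiff_one_deriv hG
  have hp := Real.two_pi_pos.ne'
  have hd : Differentiable ℝ G := hG.differentiable (by norm_num)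
  have hd1 : Differentiable ℝ (deriv G) := hG1.differentiable (by norm_num)
  obtain ⟨M₀, hM₀⟩ := hper.exists_abs_le hp hG.continuous
  obtain ⟨M₁, hM₁⟩ := hper.deriv_periodic.exists_abs_le hp hG1.continuous
  obtain ⟨M₂, hM₂⟩ := hper.deriv_periodic.deriv_periodic.exists_abs_le hp
    (hG1.continuous_deriv le_rfl)
  refine ⟨M₁ / 2 + M₂ / 2 + 2 * (M₀ + M₁), ?_⟩
  rintro z ⟨θ, -, δ, hδ, ξ, hξ, h₁, h₂, h₃, h₄⟩
  rw [deriv_deriv_addFirstMode hd hd1] at h₄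
  rw [deriv_addFirstMode hd] at h₁ h₂
  set u := z * exp (I * θ) with hu
  have hrot : ∀ t : ℝ, z * exp (I * (θ + t : ℝ)) = u * exp (I * t) := by
    intro t
    rw [hu, mul_assoc, ← exp_add]
    push_cast
    ring_nf
  have hznorm : ‖z‖ = ‖u‖ := by rw [hu, norm_mul, norm_exp_I_mul, mul_one]
  simp only [addFirstMode, mul_assoc, hrot, ← hu] at h₁ h₂ h₃ h₄
  simp only [← mul_assoc I I, I_mul_I, I_mul_re, neg_one_mul, neg_re] at h₁ h₂ h₄
  have a₁ := abs_le.1 (hM₁ θ)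
  have a₂ := abs_le.1 (hM₁ (θ + δ))
  have a₃ := abs_le.1 (hM₀ θ)
  have a₄ := abs_le.1 (hM₀ (θ + δ))
  have a₅ := abs_le.1 (hM₂ (θ + ξ))
  have hdiff : ‖u * (exp (I * δ) - 1)‖ ≤ M₀ + M₁ := by
    refine (norm_le_abs_re_add_abs_im _).trans (add_le_add ?_ ?_) <;>
    · rw [mul_sub, mul_one]
      first | rw [sub_re] | rw [sub_im]
      rw [abs_le]
      constructor <;> linarith
  have hδu : ‖u‖ * δ ≤ 2 * (M₀ + M₁) := by
    rw [norm_mul] at hdiff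
    have h := mul_le_mul_of_nonneg_left (two_div_pi_mul_le_norm_exp_sub_one hδ) (norm_nonneg u)
    have h' : 1 / 2 * (‖u‖ * δ) ≤ 2 / Real.pi * (‖u‖ * δ) := by
      refine mul_le_mul_of_nonneg_right ?_ (mul_nonneg (norm_nonneg _) hδ.1)
      rw [div_le_div_iff₀ two_pos Real.pi_pos]
      linarith [Real.pi_le_four]
    linarith
  have hξu : ‖u * (exp (I * ξ) - 1)‖ ≤ 2 * (M₀ + M₁) := by
    rw [norm_mul]
    refine le_trans ?_ hδu
    gcongr
    refine Real.norm_exp_I_mul_ofReal_sub_one_le.trans ?_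
    rw [Real.norm_of_nonneg hξ.1]
    exact hξ.2
  have hre := abs_le.1 ((abs_re_le_norm _).trans hξu)
  rw [mul_sub, mul_one, sub_re] at hre
  rw [hznorm]
  have hu_re : |u.re| ≤ M₂ / 2 + 2 * (M₀ + M₁) := by
    rw [abs_le]
    constructor <;> linarith
  have hu_im : |u.im| ≤ M₁ / 2 := by
    rw [abs_le]
    constructor <;> linarith
  linarith [norm_le_abs_re_add_abs_im u]

theorem isCompact_exceptionalParameters (hG : ContDiff ℝ 2 G)
    (hper : Function.Periodic G (2 * Real.pi)) : IsCompact (exceptionalParameters G) := by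
  have hG1 := contDiff_one_deriv hG
  have hd : Differentiable ℝ G := hG.differentiable (by norm_num)
  have hd1 : Differentiable ℝ (deriv G) := hG1.differentiable (by norm_num)
  have c₀ := (contDiff_addFirstMode hG).continuous
  have c₁ := (contDiff_addFirstMode hG1).continuous
  have c₂ := (contDiff_addFirstMode (contDiff_zero.2 (hG1.continuous_deriv le_rfl))).continuous
  obtain ⟨R, hR⟩ := exists_norm_le_of_mem_exceptionalParameters hG hper
  let T : Set (ℂ × ℝ × ℝ × ℝ) := {p | p.2.2.2 ≤ p.2.2.1 ∧
    addFirstMode (deriv G) (I * p.1) p.2.1 = 0 ∧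
    addFirstMode (deriv G) (I * p.1) (p.2.1 + p.2.2.1) = 0 ∧
    addFirstMode G p.1 p.2.1 = addFirstMode G p.1 (p.2.1 + p.2.2.1) ∧
    addFirstMode (deriv (deriv G)) (I * (I * p.1)) (p.2.1 + p.2.2.2) = 0}
  have hz : Continuous fun p : ℂ × ℝ × ℝ × ℝ => p.1 := continuous_fst
  have hIz : Continuous fun p : ℂ × ℝ × ℝ × ℝ => I * p.1 := by fun_prop
  have hIIz : Continuous fun p : ℂ × ℝ × ℝ × ℝ => I * (I * p.1) := by fun_prop
  have hθ : Continuous fun p : ℂ × ℝ × ℝ × ℝ => p.2.1 := by fun_prop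
  have hθδ : Continuous fun p : ℂ × ℝ × ℝ × ℝ => p.2.1 + p.2.2.1 := by fun_prop
  have hθξ : Continuous fun p : ℂ × ℝ × ℝ × ℝ => p.2.1 + p.2.2.2 := by fun_prop
  have hξ : Continuous fun p : ℂ × ℝ × ℝ × ℝ => p.2.2.2 := by fun_prop
  have hδ : Continuous fun p : ℂ × ℝ × ℝ × ℝ => p.2.2.1 := by fun_prop
  have hT : IsClosed T := (isClosed_le hξ hδ).inter <|
    (isClosed_eq (c₁.comp (hIz.prodMk hθ)) (continuous_const (y := (0 : ℝ)))).inter <|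
    (isClosed_eq (c₁.comp (hIz.prodMk hθδ)) (continuous_const (y := (0 : ℝ)))).inter <|
    (isClosed_eq (c₀.comp (hz.prodMk hθ)) (c₀.comp (hz.prodMk hθδ))).inter <|
    isClosed_eq (c₂.comp (hIIz.prodMk hθξ)) (continuous_const (y := (0 : ℝ)))
  have hK : IsCompact (Metric.closedBall (0 : ℂ) R ×ˢ Set.Icc 0 (2 * Real.pi) ×ˢ
      Set.Icc 0 Real.pi ×ˢ Set.Icc 0 Real.pi) :=
    (isCompact_closedBall _ _).prod (isCompact_Icc.prod (isCompact_Icc.prod isCompact_Icc))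
  convert (hK.inter_right hT).image continuous_fst using 1
  ext z
  constructor
  · intro hzΓ
    have hzR := hR z hzΓ
    obtain ⟨θ, hθ, δ, hδ, ξ, hξ, h⟩ := hzΓ
    rw [deriv_deriv_addFirstMode hd hd1, deriv_addFirstMode hd] at h
    exact ⟨(z, θ, δ, ξ), ⟨⟨by simpa using hzR, hθ, hδ, hξ.1, hξ.2.trans hδ.2⟩, hξ.2, h⟩, rfl⟩
  · rintro ⟨⟨w, θ, δ, ξ⟩, ⟨⟨-, hθ, hδ, hξ⟩, hξδ, h⟩, rfl⟩
    refine ⟨θ, hθ, δ, hδ, ξ, ⟨hξ.1, hξδ⟩, ?_⟩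
    rw [deriv_deriv_addFirstMode hd hd1, deriv_addFirstMode hd]
    exact h

theorem exists_rat_Icc_subset_of_mem_nhds {s : Set ℝ} {x : ℝ} (hs : s ∈ nhds x) :
    ∃ a b : ℚ, x ∈ Set.Icc (a : ℝ) b ∧ Set.Icc (a : ℝ) b ⊆ s := by
  obtain ⟨l, r, hx, hlr⟩ := mem_nhds_iff_exists_Ioo_subset.1 hs
  obtain ⟨a, ha, ha'⟩ := exists_rat_btwn hx.1
  obtain ⟨b, hb, hb'⟩ := exists_rat_btwn hx.2
  exact ⟨a, b, ⟨ha'.le, hb.le⟩, fun y hy => hlr ⟨ha.trans_le hy.1, hy.2.trans_lt hb'⟩⟩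

/-- The parameters for which some two nondegenerate critical points, localised in `[a, b]` and
`[c, d]`, have the same value. -/
def coincidenceParameters (G : ℝ → ℝ) (a b c d : ℝ) : Set ℂ :=
  {z | ∃ θ₁ ∈ Set.Icc a b, ∃ θ₂ ∈ Set.Icc c d, exp (I * θ₁) ≠ exp (I * θ₂) ∧
    deriv (addFirstMode G z) θ₁ = 0 ∧ deriv (addFirstMode G z) θ₂ = 0 ∧
    addFirstMode G z θ₁ = addFirstMode G z θ₂ ∧
    (∀ x ∈ Set.Icc a b, deriv (deriv (addFirstMode G z)) x ≠ 0) ∧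
    ∀ x ∈ Set.Icc c d, deriv (deriv (addFirstMode G z)) x ≠ 0}

theorem volume_coincidenceParameters (hG : ContDiff ℝ 2 G) (a b c d : ℝ) :
    MeasureTheory.volume (coincidenceParameters G a b c d) = 0 := by
  refine volume_eq_zero_of_thin ?_
  rintro z ⟨θ₁, hθ₁, θ₂, hθ₂, hne, h₁, h₂, hval, hnd₁, hnd₂⟩
  obtain ⟨C₁, hC₁⟩ := exists_critical_value_estimate hG hθ₁ h₁ hnd₁
  obtain ⟨C₂, hC₂⟩ := exists_critical_value_estimate hG hθ₂ h₂ hnd₂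
  refine ⟨_, sub_ne_zero.2 hne, C₁ + C₂, ?_⟩
  rintro w ⟨x₁, hx₁, x₂, hx₂, -, k₁, k₂, kval, -, -⟩
  have e₁ := abs_le.1 (hC₁ w x₁ hx₁ k₁)
  have e₂ := abs_le.1 (hC₂ w x₂ hx₂ k₂)
  rw [mul_sub (w - z), sub_re, abs_le, add_mul]
  constructor <;> linarith

theorem volume_exceptionalParameters (hG : ContDiff ℝ 3 G) :
    MeasureTheory.volume (exceptionalParameters G) = 0 := by
  have hG2 : ContDiff ℝ 2 G := hG.of_le (by norm_num)
  have hG1 : ContDiff ℝ 2 (deriv G) := by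
    have h : ContDiff ℝ (2 + 1) G := by simpa [two_add_one_eq_three] using hG
    exact (contDiff_succ_iff_deriv.1 h).2.2
  have hd : Differentiable ℝ G := hG.differentiable (by norm_num)
  have hd1 : Differentiable ℝ (deriv G) := hG1.differentiable (by norm_num)
  have hd2 : Differentiable ℝ (deriv (deriv G)) :=
    (contDiff_one_deriv hG1).differentiable (by norm_num)
  let γ : ℝ → ℂ := fun θ =>
    (((deriv (deriv G) θ : ℝ) : ℂ) + ((deriv G θ : ℝ) : ℂ) * I) * (1 / 2) * exp (I * (-θ : ℝ))
  have hγ : Differentiable ℝ γ := by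
    intro θ
    have e₁ := (hd1 θ).hasDerivAt.ofReal_comp
    have e₂ := (hd2 θ).hasDerivAt.ofReal_comp
    have e₃ := (hasDerivAt_exp_I_mul (-θ)).scomp θ (hasDerivAt_neg θ)
    exact (((e₂.add (e₁.mul_const I)).mul_const (1 / 2)).mul e₃).differentiableAt
  have hdeg : ∀ z : ℂ, ∀ θ : ℝ, deriv (addFirstMode G z) θ = 0 →
      deriv (deriv (addFirstMode G z)) θ = 0 → z ∈ Set.range γ := by
    intro z θ h₁ h₂
    refine ⟨θ, ?_⟩
    rw [deriv_deriv_addFirstMode hd hd1] at h₂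
    rw [deriv_addFirstMode hd] at h₁
    set u := z * exp (I * θ) with hu
    simp only [addFirstMode, mul_assoc, ← hu] at h₁ h₂
    simp only [← mul_assoc I I, I_mul_I, I_mul_re, neg_one_mul, neg_re] at h₁ h₂
    have hzu : z = u * exp (I * (-θ : ℝ)) := by
      rw [hu, mul_assoc, ← exp_add]
      simp
    have huv : (((deriv (deriv G) θ : ℝ) : ℂ) + ((deriv G θ : ℝ) : ℂ) * I) * (1 / 2) = u := by
      apply Complex.ext <;> simp <;> linarith
    simp only [γ]
    rw [huv, ← hzu]
  have hsub : exceptionalParameters G ⊆ Set.range γ ∪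
      ⋃ q : ℚ × ℚ × ℚ × ℚ, coincidenceParameters G q.1 q.2.1 q.2.2.1 q.2.2.2 := by
    rintro z ⟨θ, -, δ, hδ, ξ, hξ, h₁, h₂, h₃, h₄⟩
    by_cases hz : z ∈ Set.range γ
    · exact Or.inl hz
    right
    have hδ0 : 0 < δ := by
      refine lt_of_le_of_ne hδ.1 fun h => hz (hdeg z θ h₁ ?_)
      have : ξ = 0 := le_antisymm (hξ.2.trans h.symm.le) hξ.1
      simpa [this] using h₄
    have hcont : Continuous (deriv (deriv (addFirstMode G z))) :=
      (contDiff_one_deriv (contDiff_addFirstMode_apply hG2 z)).continuous_deriv le_rfl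
    have hloc : ∀ x, deriv (addFirstMode G z) x = 0 → ∃ a b : ℚ, x ∈ Set.Icc (a : ℝ) b ∧
        Set.Icc (a : ℝ) b ⊆ {y | deriv (deriv (addFirstMode G z)) y ≠ 0} := fun x hx =>
      exists_rat_Icc_subset_of_mem_nhds <|
        hcont.continuousAt.eventually_ne fun h => hz (hdeg z x hx h)
    obtain ⟨a, b, hab, hnd⟩ := hloc θ h₁
    obtain ⟨c, d, hcd, hnd'⟩ := hloc (θ + δ) h₂
    refine Set.mem_iUnion.2 ⟨(a, b, c, d), θ, hab, θ + δ, hcd, fun h => ?_, h₁, h₂, h₃, hnd, hnd'⟩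
    have hexp : exp (I * δ) = 1 := by
      have h' : exp (I * (θ + δ : ℝ)) = exp (I * θ) * exp (I * δ) := by
        rw [← exp_add]
        push_cast
        ring_nf
      rw [h'] at h
      exact (mul_eq_left₀ (exp_ne_zero _)).1 h.symm
    have h' := two_div_pi_mul_le_norm_exp_sub_one hδ
    rw [hexp, sub_self, norm_zero] at h'
    have : 0 < 2 / Real.pi * δ := mul_pos (div_pos two_pos Real.pi_pos) hδ0
    linarith
  refine MeasureTheory.measure_mono_null hsub (MeasureTheory.measure_union_null
    (volume_range_eq_zero_of_differentiable hγ) (MeasureTheory.measure_iUnion_null fun q => ?_))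
  exact volume_coincidenceParameters hG2 _ _ _ _

theorem mem_exceptionalParameters (hper : Function.Periodic G (2 * Real.pi)) {θ δ ξ : ℝ}
    (hδ : δ ∈ Set.Icc 0 Real.pi) (hξ : ξ ∈ Set.Icc 0 δ)
    (h₁ : deriv (addFirstMode G z) θ = 0) (h₂ : deriv (addFirstMode G z) (θ + δ) = 0)
    (h₃ : addFirstMode G z θ = addFirstMode G z (θ + δ))
    (h₄ : deriv (deriv (addFirstMode G z)) (θ + ξ) = 0) : z ∈ exceptionalParameters G := by
  have p := periodic_addFirstMode hper z
  have p₁ := p.deriv_periodic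
  have p₂ := p₁.deriv_periodic
  set k := toIcoDiv Real.two_pi_pos 0 θ
  have hmem := toIcoMod_mem_Ico Real.two_pi_pos 0 θ
  rw [zero_add] at hmem
  have hsub : ∀ t, toIcoMod Real.two_pi_pos 0 θ + t = θ + t - k • (2 * Real.pi) := fun t => by
    rw [toIcoMod]
    ring
  have hθ : toIcoMod Real.two_pi_pos 0 θ = θ - k • (2 * Real.pi) := rfl
  refine ⟨_, Set.Ico_subset_Icc_self hmem, δ, hδ, ξ, hξ, ?_⟩
  rw [hsub, hsub, hθ, p₁.sub_zsmul_eq, p₁.sub_zsmul_eq, p.sub_zsmul_eq, p.sub_zsmul_eq,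
    p₂.sub_zsmul_eq]
  exact ⟨h₁, h₂, h₃, h₄⟩

theorem mem_exceptionalParameters_of_pair (hG : ContDiff ℝ 2 G)
    (hper : Function.Periodic G (2 * Real.pi)) {θ δ : ℝ} (hδ : 0 < δ) (hδπ : δ ≤ Real.pi)
    (h₁ : deriv (addFirstMode G z) θ = 0) (h₂ : deriv (addFirstMode G z) (θ + δ) = 0)
    (h₃ : addFirstMode G z θ = addFirstMode G z (θ + δ)) : z ∈ exceptionalParameters G := by
  have hcont := (contDiff_one_deriv (contDiff_addFirstMode_apply hG z)).continuous
  obtain ⟨y, hy, hy'⟩ := exists_deriv_eq_zero (f := deriv (addFirstMode G z))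
    (lt_add_of_pos_right θ hδ) hcont.continuousOn (h₁.trans h₂.symm)
  refine mem_exceptionalParameters hper (ξ := y - θ) ⟨hδ.le, hδπ⟩ ⟨?_, ?_⟩ h₁ h₂ h₃ (by simpa)
  · linarith [hy.1]
  · linarith [hy.2]

theorem morseWithDistinctValues_of_notMem (hG : ContDiff ℝ 2 G)
    (hper : Function.Periodic G (2 * Real.pi)) (hz : z ∉ exceptionalParameters G) :
    MorseWithDistinctValues (addFirstMode G z) := by
  refine ⟨fun θ h h' => hz ?_, fun θ₁ θ₂ h₁ h₂ h₃ => ?_⟩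
  · exact mem_exceptionalParameters hper (θ := θ) (δ := 0) (ξ := 0) ⟨le_rfl, Real.pi_pos.le⟩
      ⟨le_rfl, le_rfl⟩ h (by simpa) (by simp) (by simpa)
  · by_contra hne
    have p := periodic_addFirstMode hper z
    set k := toIcoDiv Real.two_pi_pos 0 (θ₁ - θ₂)
    set δ := toIcoMod Real.two_pi_pos 0 (θ₁ - θ₂)
    have hmem : δ ∈ Set.Ico 0 (2 * Real.pi) := by
      simpa using toIcoMod_mem_Ico Real.two_pi_pos 0 (θ₁ - θ₂)
    have hdecomp : δ + k • (2 * Real.pi) = θ₁ - θ₂ :=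
      toIcoMod_add_toIcoDiv_zsmul Real.two_pi_pos 0 _
    have hpos : 0 < δ := by
      refine lt_of_le_of_ne hmem.1 fun h => hne ⟨k, ?_⟩
      rw [← hdecomp, ← h, zsmul_eq_mul]
      ring
    rcases le_total δ Real.pi with hle | hge
    · have e : θ₂ + δ = θ₁ - k • (2 * Real.pi) := by linarith
      refine hz (mem_exceptionalParameters_of_pair hG hper hpos hle h₂ ?_ ?_)
      · rw [e, p.deriv_periodic.sub_zsmul_eq, h₁]
      · rw [e, p.sub_zsmul_eq, h₃]
    · have e : θ₁ + (2 * Real.pi - δ) = θ₂ + (k + 1) • (2 * Real.pi) := by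
        rw [add_smul, one_smul]
        linarith
      refine hz (mem_exceptionalParameters_of_pair hG hper (δ := 2 * Real.pi - δ)
        (by linarith [hmem.2]) (by linarith) h₁ ?_ ?_)
      · rw [e, p.deriv_periodic.zsmul (k + 1), h₂]
      · rw [e, p.zsmul (k + 1), h₃]

end ExceptionalSet

section FourierSeries

theorem hasDerivAt_cexp_mode (c : ℂ) (j : ℤ) (θ : ℝ) :
    HasDerivAt (fun x : ℝ => c * exp (I * j * x)) (c * (I * j) * exp (I * j * θ)) θ := by
  have h := (((ofRealCLM.hasDerivAt (x := θ)).const_mul (I * j)).cexp).const_mul c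
  simpa [mul_comm, mul_left_comm, mul_assoc] using h

theorem norm_cexp_mode (j : ℤ) (θ : ℝ) : ‖exp (I * j * θ)‖ = 1 := by
  have h : I * j * θ = ((j * θ : ℝ) : ℂ) * I := by
    push_cast
    ring
  rw [h, norm_exp_ofReal_mul_I]

theorem hasDerivAt_tsum_cexp_mode {c : ℤ → ℂ}
    (hc : ∀ k : ℕ, Summable fun j : ℤ => |(j : ℝ)| ^ k * ‖c j‖) (θ : ℝ) :
    HasDerivAt (fun θ : ℝ => ∑' j : ℤ, c j * exp (I * j * θ))
      (∑' j : ℤ, c j * (I * j) * exp (I * j * θ)) θ := by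
  have hsum : Summable fun j : ℤ => c j * exp (I * j * (0 : ℝ)) :=
    Summable.of_norm <| by simpa using hc 0
  refine hasDerivAt_tsum (hc 1) (fun j y => hasDerivAt_cexp_mode (c j) j y) (fun j y => ?_) hsum θ
  rw [norm_mul, norm_cexp_mode, norm_mul, norm_mul, norm_I, norm_intCast]
  simp [mul_comm]

theorem contDiff_tsum_cexp_mode (n : ℕ) {c : ℤ → ℂ}
    (hc : ∀ k : ℕ, Summable fun j : ℤ => |(j : ℝ)| ^ k * ‖c j‖) :
    ContDiff ℝ n fun θ : ℝ => ∑' j : ℤ, c j * exp (I * j * θ) := by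
  have hder := fun θ => hasDerivAt_tsum_cexp_mode hc θ
  induction n generalizing c with
  | zero =>
    exact contDiff_zero.2 (continuous_iff_continuousAt.2 fun θ => (hder θ).continuousAt)
  | succ n ih =>
    have hc' : ∀ k : ℕ, Summable fun j : ℤ => |(j : ℝ)| ^ k * ‖c j * (I * j)‖ := fun k => by
      refine (hc (k + 1)).congr fun j => ?_
      rw [norm_mul, norm_mul, norm_I, norm_intCast]
      ring
    rw [Nat.cast_succ, contDiff_succ_iff_deriv]
    refine ⟨fun θ => (hder θ).differentiableAt, by simp, ?_⟩
    rw [funext fun θ => (hder θ).deriv]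
    exact ih hc' fun θ => hasDerivAt_tsum_cexp_mode hc' θ

theorem summable_abs_pow_mul_exp_neg_mul_abs {ρ : ℝ} (hρ : 0 < ρ) (k : ℕ) :
    Summable fun j : ℤ => |(j : ℝ)| ^ k * Real.exp (-ρ * |(j : ℝ)|) := by
  have h := Real.summable_pow_mul_exp_neg_nat_mul k hρ
  refine Summable.of_nat_of_neg ?_ ?_ <;> simpa using h

end FourierSeries

theorem stmt_5 (b : ℤ → ℂ)
    (hreal : ∀ j : ℤ, b (-j) = (starRingEnd ℂ) (b j))
    (hanalytic : ∃ C ρ : ℝ, 0 < ρ ∧ ∀ j : ℤ, ‖b j‖ ≤ C * Real.exp (-ρ * |(j : ℝ)|)) :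
    ∃ Γ : Set ℂ, IsCompact Γ ∧ MeasureTheory.volume Γ = 0 ∧
      ∀ z : ℂ, z ∉ Γ → MorseWithDistinctValues (Fone b z) := by
  obtain ⟨C, ρ, hρ, hb⟩ := hanalytic
  let c : ℤ → ℂ := fun j => if j = 1 then 0 else if j = -1 then 0 else b j
  have hcb : ∀ j, ‖c j‖ ≤ ‖b j‖ := fun j => by
    simp only [c]
    split_ifs <;> simp
  have hc : ∀ k : ℕ, Summable fun j : ℤ => |(j : ℝ)| ^ k * ‖c j‖ := fun k => by
    refine Summable.of_nonneg_of_le (fun j => by positivity) (fun j => ?_)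
      ((summable_abs_pow_mul_exp_neg_mul_abs hρ k).mul_left C)
    rw [mul_left_comm]
    gcongr
    exact (hcb j).trans (hb j)
  let G : ℝ → ℝ := fun θ => (∑' j : ℤ, c j * exp (I * j * θ)).re
  have hG : ContDiff ℝ 3 G := reCLM.contDiff.comp (contDiff_tsum_cexp_mode 3 hc)
  have hper : Function.Periodic G (2 * Real.pi) := fun θ => by
    have h : ∀ j : ℤ, exp (I * j * (θ + 2 * Real.pi : ℝ)) = exp (I * j * θ) := fun j => by
      rw [← mul_one (exp (I * j * θ)), ← exp_int_mul_two_pi_mul_I j, ← exp_add]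
      push_cast
      ring_nf
    simp only [G, h]
  have hF : ∀ z, Fone b z = addFirstMode G z := fun z => by
    ext θ
    have hsum : Summable fun j : ℤ => c j * exp (I * j * θ) :=
      Summable.of_norm <| by simpa [norm_cexp_mode] using hc 0
    have h₁ := hasSum_ite_eq (1 : ℤ) (z * exp (I * θ))
    have h₂ := hasSum_ite_eq (-1 : ℤ) ((starRingEnd ℂ) (z * exp (I * θ)))
    have hconj : (starRingEnd ℂ) (exp (I * θ)) = exp (-(I * θ)) := by
      rw [← exp_conj]
      simp
    have h : ∀ j : ℤ, (if j = 1 then z else if j = -1 then (starRingEnd ℂ) z else b j) *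
        exp (I * j * θ) = c j * exp (I * j * θ) + (if j = 1 then z * exp (I * θ) else 0) +
          (if j = -1 then (starRingEnd ℂ) (z * exp (I * θ)) else 0) := fun j => by
      rw [map_mul, hconj]
      by_cases hj : j = 1
      · subst hj
        simp [c]
      · by_cases hj' : j = -1
        · subst hj'
          simp [c]
        · simp [c, hj, hj']
    rw [Fone, funext h, ((hsum.hasSum.add h₁).add h₂).tsum_eq, add_re, add_re, conj_re,
      addFirstMode]
    ring
  refine ⟨exceptionalParameters G, isCompact_exceptionalParameters (hG.of_le (by norm_num)) hper,
    volume_exceptionalParameters hG, fun z hz => ?_⟩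
  rw [hF]
  exact morseWithDistinctValues_of_notMem (hG.of_le (by norm_num)) hper hz

end
end
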